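/- arXiv:1903.09009 — 4 statements merged into one kernel-verified Lean document; each statement's English description precedes it below -/
import Mathlib

section
/- Let R_1,…,R_n : ℝ^N → ℝ^N be (1/β)-cocoercive operators. If x, y ∈ ℝ^N both satisfy ∑_{i=1}^n R_i x = 0 and ∑_{i=1}^n R_i y = 0, then R_i x = R_i y for every i ∈ {1,…,n}; that is, the values R_i x⋆ are the same for every solution x⋆ of the root finding problem 0 = (1/n)∑_{i=1}^n R_i x. -/
open Finset RealInnerProductSpace

/-- If `R₁,…,Rₙ : ℝ^N → ℝ^N` are `(1/β)`-cocoercive operators and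
`x, y` both satisfy `∑ᵢ Rᵢ x = 0` and `∑ᵢ Rᵢ y = 0`, then `Rᵢ x = Rᵢ y` for every `i`. -/
theorem svag_solution_operator_values_unique
    {N n : ℕ} (β : ℝ) (hβ : 0 < β)
    (R : Fin n → EuclideanSpace ℝ (Fin N) → EuclideanSpace ℝ (Fin N))
    (hcoco : ∀ i, ∀ x y : EuclideanSpace ℝ (Fin N),
      ⟪R i x - R i y, x - y⟫ ≥ (1 / β) * ‖R i x - R i y‖ ^ 2)
    (x y : EuclideanSpace ℝ (Fin N))
    (hx : ∑ i, R i x = 0) (hy : ∑ i, R i y = 0) :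
    ∀ i, R i x = R i y := by
  have hnonneg : ∀ i ∈ univ, 0 ≤ (1 / β) * ‖R i x - R i y‖ ^ 2 := fun i _ => by positivity
  have hinner : ∑ i, ⟪R i x - R i y, x - y⟫ = 0 := by
    rw [← sum_inner, sum_sub_distrib, hx, hy, sub_zero, inner_zero_left]
  have hsum : ∑ i, (1 / β) * ‖R i x - R i y‖ ^ 2 = 0 :=
    le_antisymm (hinner ▸ sum_le_sum fun i _ => hcoco i x y) (sum_nonneg hnonneg)
  intro i
  have hi := (sum_eq_zero_iff_of_nonneg hnonneg).1 hsum i (mem_univ i)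
  simpa [hβ.ne', sub_eq_zero] using hi
end

section
/- Let R_1,…,R_n : ℝ^N → ℝ^N be (1/β)-cocoercive operators and suppose the solution set X⋆ = {x : 0 = (1/n)∑_{i=1}^n R_i x} is nonempty. Then the set Z⋆ = {(x, R_1 x, …, R_n x) : x ∈ X⋆} ⊆ ℝ^{N(n+1)} is closed and convex. -/
open Finset RealInnerProductSpace

section Cocoercive

variable {E : Type*} [NormedAddCommGroup E] [InnerProductSpace ℝ E]

/-- A `c`-cocoercive operator is `c⁻¹`-Lipschitz, hence continuous. -/
lemma continuous_of_cocoercive {c : ℝ} (hc : 0 < c) {T : E → E}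
    (hT : ∀ x y, c * ‖T x - T y‖ ^ 2 ≤ ⟪T x - T y, x - y⟫) : Continuous T := by
  refine (LipschitzWith.of_dist_le' (K := c⁻¹) fun x y ↦ ?_).continuous
  rw [dist_eq_norm, dist_eq_norm, inv_mul_eq_div, le_div_iff₀' hc]
  rcases (norm_nonneg (T x - T y)).eq_or_lt with h | h
  · rw [← h, mul_zero]
    exact norm_nonneg _
  · refine le_of_mul_le_mul_left ?_ h
    linarith [hT x y, real_inner_le_norm (T x - T y) (x - y)]

/-- The fibers of a cocoercive operator are convex. -/
lemma convex_fiber_of_cocoercive {c : ℝ} (hc : 0 < c) {T : E → E}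
    (hT : ∀ x y, c * ‖T x - T y‖ ^ 2 ≤ ⟪T x - T y, x - y⟫) (u : E) :
    Convex ℝ {x | T x = u} := by
  intro x hx y hy a b ha hb hab
  simp only [Set.mem_ofPred_eq] at hx hy ⊢
  set z := a • x + b • y with hz
  have hzx := hT z x
  have hzy := hT z y
  rw [hx] at hzx
  rw [hy] at hzy
  have hcomb : a • (z - x) + b • (z - y) = 0 := by
    have : a • (z - x) + b • (z - y) = (a + b) • z - z := by rw [hz]; module
    rw [this, hab, one_smul, sub_self]
  have hinner : a * ⟪T z - u, z - x⟫ + b * ⟪T z - u, z - y⟫ = 0 := by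
    rw [← real_inner_smul_right, ← real_inner_smul_right, ← inner_add_right, hcomb,
      inner_zero_right]
  have hle : c * ‖T z - u‖ ^ 2 ≤ 0 := by
    calc c * ‖T z - u‖ ^ 2
        = a * (c * ‖T z - u‖ ^ 2) + b * (c * ‖T z - u‖ ^ 2) := by
          rw [← add_mul, hab, one_mul]
      _ ≤ a * ⟪T z - u, z - x⟫ + b * ⟪T z - u, z - y⟫ := by gcongr
      _ = 0 := hinner
  have hsq : ‖T z - u‖ ^ 2 = 0 := le_antisymm (nonpos_of_mul_nonpos_right hle hc) (sq_nonneg _)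
  exact sub_eq_zero.mp (norm_eq_zero.mp (pow_eq_zero_iff two_ne_zero |>.mp hsq))

/-- Where the sums of cocoercive operators agree, the individual operators agree. -/
lemma eq_of_sum_eq_of_cocoercive {ι : Type*} [Fintype ι] {c : ℝ} (hc : 0 < c) {T : ι → E → E}
    (hT : ∀ i x y, c * ‖T i x - T i y‖ ^ 2 ≤ ⟪T i x - T i y, x - y⟫) {x y : E}
    (hxy : ∑ i, T i x = ∑ i, T i y) (i : ι) : T i x = T i y := by
  have hsum : ∑ j, ⟪T j x - T j y, x - y⟫ = 0 := by
    rw [← sum_inner, Finset.sum_sub_distrib, hxy, sub_self, inner_zero_left]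
  have hnonneg : ∀ j ∈ univ, 0 ≤ ⟪T j x - T j y, x - y⟫ := fun j _ ↦
    (by positivity : 0 ≤ c * ‖T j x - T j y‖ ^ 2).trans (hT j x y)
  have hle := hT i x y
  rw [(Finset.sum_eq_zero_iff_of_nonneg hnonneg).mp hsum i (mem_univ i)] at hle
  have hsq : ‖T i x - T i y‖ ^ 2 = 0 :=
    le_antisymm (nonpos_of_mul_nonpos_right hle hc) (sq_nonneg _)
  exact sub_eq_zero.mp (norm_eq_zero.mp (pow_eq_zero_iff two_ne_zero |>.mp hsq))

end Cocoercive

/-- If `R₁,…,Rₙ : ℝ^N → ℝ^N` are `(1/β)`-cocoercive and the solution set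
`X⋆ = {x : (1/n)∑ᵢ Rᵢ x = 0}` is nonempty, then
`Z⋆ = {(x, R₁x, …, Rₙx) : x ∈ X⋆} ⊆ ℝ^{N(n+1)}` is closed and convex. -/
theorem svag_solution_set_closed_convex
    {N n : ℕ} (β : ℝ) (hβ : 0 < β)
    (R : Fin n → EuclideanSpace ℝ (Fin N) → EuclideanSpace ℝ (Fin N))
    (hcoco : ∀ i, ∀ x y : EuclideanSpace ℝ (Fin N),
      ⟪R i x - R i y, x - y⟫ ≥ (1 / β) * ‖R i x - R i y‖ ^ 2)
    (hne : ∃ x : EuclideanSpace ℝ (Fin N), (n : ℝ)⁻¹ • ∑ i, R i x = 0)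
    (Zstar : Set (EuclideanSpace ℝ (Fin N) × (Fin n → EuclideanSpace ℝ (Fin N))))
    (hZstar : Zstar = {z | (n : ℝ)⁻¹ • ∑ i, R i z.1 = 0 ∧ ∀ i, z.2 i = R i z.1}) :
    IsClosed Zstar ∧ Convex ℝ Zstar := by
  have hc : 0 < 1 / β := one_div_pos.mpr hβ
  have hcont : ∀ i, Continuous (R i) := fun i ↦ continuous_of_cocoercive hc (hcoco i)
  have hscale : ∀ v : EuclideanSpace ℝ (Fin N), (n : ℝ)⁻¹ • v = 0 → n ≠ 0 → v = 0 :=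
    fun v hv hn ↦ (smul_eq_zero_iff_right (inv_ne_zero (Nat.cast_ne_zero.mpr hn))).mp hv
  subst hZstar
  constructor
  · simp only [Set.ofPred_and, Set.ofPred_forall]
    refine IsClosed.inter (isClosed_eq (by fun_prop) continuous_const) ?_
    exact isClosed_iInter fun i ↦ isClosed_eq (by fun_prop) (by fun_prop)
  · rintro ⟨x, p⟩ ⟨hx, hp⟩ ⟨y, q⟩ ⟨hy, hq⟩ a b ha hb hab
    dsimp only at hx hp hy hq
    have hRxy : ∀ i, R i y = R i x := fun i ↦
      eq_of_sum_eq_of_cocoercive hc hcoco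
        ((hscale _ hy i.pos.ne').trans (hscale _ hx i.pos.ne').symm) i
    have hRz : ∀ i, R i (a • x + b • y) = R i x := fun i ↦
      convex_fiber_of_cocoercive hc (hcoco i) (R i x) rfl (hRxy i) ha hb hab
    refine ⟨?_, fun i ↦ ?_⟩
    · simpa [hRz] using hx
    · change a • p i + b • q i = R i (a • x + b • y)
      rw [hp, hq, hRxy, hRz, ← add_smul, hab, one_smul]
end

section
/- Let (Ω, 𝓕, P) be a probability space and 𝓕_0 ⊂ 𝓕_1 ⊂ … a sequence of sub-σ-algebras of 𝓕. For all k ∈ {0,1,…}, let z^k, β^k, ξ^k, and ζ^k be non-negative 𝓕_k-measurable random variables. If ∑_{i=0}^∞ β^i < ∞, ∑_{i=0}^∞ ξ^i < ∞, and E[z^{k+1} | 𝓕_k] ≤ (1 + β^k)z^k + ξ^k − ζ^k holds almost surely for all k, then z^k converges almost surely to a finite-valued random variable and ∑_{i=0}^∞ ζ^i < ∞ almost surely. -/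
open MeasureTheory Filter Topology

/-- A supermartingale that is bounded below by a constant converges almost everywhere. -/
lemma ae_tendsto_of_supermartingale_of_const_le {Ω : Type*} {m0 : MeasurableSpace Ω}
    {P : Measure Ω} [IsProbabilityMeasure P] {ℱ : Filtration ℕ m0} {V : ℕ → Ω → ℝ}
    (hV : Supermartingale V ℱ P) {a : ℝ} (ha : 0 ≤ a) (hle : ∀ k ω, -a ≤ V k ω) :
    ∀ᵐ ω ∂P, ∃ c, Tendsto (fun k => V k ω) atTop (𝓝 c) := by
  have hbdd : ∀ k, eLpNorm ((-V) k) 1 P ≤ (∫ ω, V 0 ω ∂P + 2 * a).toNNReal := by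
    intro k
    have hmono : ∫ ω, V k ω ∂P ≤ ∫ ω, V 0 ω ∂P := by
      simpa using hV.setIntegral_le (Nat.zero_le k) MeasurableSet.univ
    have hnorm : ∫ ω, ‖V k ω‖ ∂P ≤ ∫ ω, (V k ω + 2 * a) ∂P := by
      refine integral_mono (hV.integrable k).norm
        ((hV.integrable k).add (integrable_const _)) fun ω => ?_
      have := hle k ω
      exact abs_le.2 ⟨by linarith, by linarith⟩
    rw [integral_add (hV.integrable k) (integrable_const _), integral_const, probReal_univ,
      one_smul] at hnorm
    rw [Pi.neg_apply, eLpNorm_neg, eLpNorm_one_eq_lintegral_enorm,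
      ← ofReal_integral_norm_eq_lintegral_enorm (hV.integrable k)]
    exact ENNReal.ofReal_le_ofReal (by linarith)
  filter_upwards [hV.neg.exists_ae_tendsto_of_bdd hbdd] with ω ⟨c, hc⟩
  exact ⟨-c, by simpa using hc.neg⟩

/-- A nonnegative almost supermartingale, corrected by its compensating sums, converges almost
everywhere if the upward drift has uniformly bounded partial sums. -/
lemma ae_tendsto_add_sum_of_condExp_le {Ω : Type*} {m0 : MeasurableSpace Ω}
    {P : Measure Ω} [IsProbabilityMeasure P] {ℱ : Filtration ℕ m0} {u x y : ℕ → Ω → ℝ}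
    (hu_nonneg : ∀ k ω, 0 ≤ u k ω) (hy_nonneg : ∀ k ω, 0 ≤ y k ω)
    (hu_meas : ∀ k, Measurable[ℱ k] (u k)) (hx_meas : ∀ k, Measurable[ℱ k] (x k))
    (hy_meas : ∀ k, Measurable[ℱ k] (y k))
    (hu_int : ∀ k, Integrable (u k) P) (hx_int : ∀ k, Integrable (x k) P)
    (hy_int : ∀ k, Integrable (y k) P)
    {a : ℝ} (ha : 0 ≤ a) (hx_sum : ∀ k ω, ∑ i ∈ Finset.range k, x i ω ≤ a)
    (hcond : ∀ k, P[u (k + 1) | ℱ k] ≤ᵐ[P] u k + x k - y k) :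
    ∀ᵐ ω ∂P, ∃ c, Tendsto (fun k => u k ω + ∑ i ∈ Finset.range k, (y i ω - x i ω))
      atTop (𝓝 c) := by
  set S : ℕ → Ω → ℝ := fun k ω => ∑ i ∈ Finset.range k, (y i ω - x i ω)
  have hS_meas : ∀ j k, k ≤ j + 1 → Measurable[ℱ j] (S k) := by
    intro j k hk
    refine Finset.measurable_sum _ fun i hi => ?_
    have hij : i ≤ j := by have := Finset.mem_range.1 hi; omega
    exact ((hy_meas i).mono (ℱ.mono hij) le_rfl).sub ((hx_meas i).mono (ℱ.mono hij) le_rfl)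
  have hS_int : ∀ k, Integrable (S k) P := fun k =>
    integrable_finsetSum _ fun i _ => (hy_int i).sub (hx_int i)
  have hV : Supermartingale (fun k => u k + S k) ℱ P := by
    refine supermartingale_nat
      (fun k => ((hu_meas k).add (hS_meas k k k.le_succ)).stronglyMeasurable)
      (fun k => (hu_int k).add (hS_int k)) fun k => ?_
    have hS_cond : P[S (k + 1) | ℱ k] = S (k + 1) :=
      condExp_of_stronglyMeasurable (ℱ.le k) (hS_meas k (k + 1) le_rfl).stronglyMeasurable
        (hS_int _)
    filter_upwards [condExp_add (hu_int (k + 1)) (hS_int (k + 1)) (ℱ k), hcond k] with ω h1 h2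
    have hsucc : S (k + 1) ω = S k ω + (y k ω - x k ω) := Finset.sum_range_succ _ _
    rw [h1, hS_cond]
    simp only [Pi.add_apply, Pi.sub_apply] at h2 ⊢
    linarith
  refine ae_tendsto_of_supermartingale_of_const_le hV ha fun k ω => ?_
  have h1 := Finset.sum_nonneg fun i (_ : i ∈ Finset.range k) => hy_nonneg i ω
  have h2 : S k ω = _ := Finset.sum_sub_distrib (fun i => y i ω) (fun i => x i ω)
  have h3 := hx_sum k ω
  have h4 := hu_nonneg k ω
  change -a ≤ u k ω + S k ω
  linarith

/-- The Robbins–Siegmund theorem without multiplicative growth, for upward drift with uniformly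
bounded partial sums. -/
lemma ae_tendsto_and_summable_of_condExp_le {Ω : Type*} {m0 : MeasurableSpace Ω}
    {P : Measure Ω} [IsProbabilityMeasure P] {ℱ : Filtration ℕ m0} {u x y : ℕ → Ω → ℝ}
    (hu_nonneg : ∀ k ω, 0 ≤ u k ω) (hx_nonneg : ∀ k ω, 0 ≤ x k ω)
    (hy_nonneg : ∀ k ω, 0 ≤ y k ω)
    (hu_meas : ∀ k, Measurable[ℱ k] (u k)) (hx_meas : ∀ k, Measurable[ℱ k] (x k))
    (hy_meas : ∀ k, Measurable[ℱ k] (y k))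
    (hu_int : ∀ k, Integrable (u k) P) (hx_int : ∀ k, Integrable (x k) P)
    (hy_int : ∀ k, Integrable (y k) P)
    {a : ℝ} (ha : 0 ≤ a) (hx_sum : ∀ k ω, ∑ i ∈ Finset.range k, x i ω ≤ a)
    (hcond : ∀ k, P[u (k + 1) | ℱ k] ≤ᵐ[P] u k + x k - y k) :
    ∀ᵐ ω ∂P, (∃ c, Tendsto (fun k => u k ω) atTop (𝓝 c)) ∧ Summable fun i => y i ω := by
  have hcond_zero : ∀ k, P[u (k + 1) | ℱ k] ≤ᵐ[P] u k + x k - (0 : ℕ → Ω → ℝ) k := by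
    intro k
    filter_upwards [hcond k] with ω h
    have := hy_nonneg k ω
    simp only [Pi.add_apply, Pi.sub_apply, Pi.zero_apply] at h ⊢
    linarith
  filter_upwards [ae_tendsto_add_sum_of_condExp_le hu_nonneg hy_nonneg hu_meas hx_meas hy_meas
      hu_int hx_int hy_int ha hx_sum hcond,
    ae_tendsto_add_sum_of_condExp_le (y := 0) hu_nonneg (fun _ _ => le_rfl) hu_meas hx_meas
      (fun _ => measurable_const) hu_int hx_int (fun _ => integrable_zero _ _ _) ha hx_sum
      hcond_zero] with ω ⟨c, hc⟩ ⟨d, hd⟩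
  have hx : Summable fun i => x i ω :=
    summable_of_sum_range_le (fun i => hx_nonneg i ω) fun k => hx_sum k ω
  refine ⟨⟨d + ∑' i, x i ω, ?_⟩, ?_⟩
  · refine (hd.add hx.hasSum.tendsto_sum_nat).congr fun k => ?_
    simp
  · refine ((hasSum_iff_tendsto_nat_of_nonneg (fun i => hy_nonneg i ω) (c - d)).2 ?_).summable
    refine (hc.sub hd).congr fun k => ?_
    simp [Finset.sum_sub_distrib]

/-- Cutting off a nonnegative series at the first time its partial sums exceed `a` leaves partial
sums bounded by `a`. -/
lemma sum_range_ite_le_of_nonneg {x : ℕ → ℝ} (hx : ∀ i, 0 ≤ x i) {a : ℝ} (ha : 0 ≤ a) (n : ℕ) :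
    ∑ k ∈ Finset.range n, (if ∑ i ∈ Finset.range (k + 1), x i ≤ a then x k else 0) ≤ a := by
  induction n with
  | zero => simpa using ha
  | succ n ih =>
    by_cases h : ∑ i ∈ Finset.range (n + 1), x i ≤ a
    · refine (Finset.sum_le_sum fun k _ => ?_).trans h
      split_ifs
      exacts [le_rfl, hx k]
    · rw [Finset.sum_range_succ, if_neg h, add_zero]
      exact ih

/-- The weight `∏ i < k, (1 + b i)⁻¹`, set to zero once the partial sums of `x` exceed `a`. -/
noncomputable def cutoffWeight (a : ℝ) (b x : ℕ → ℝ) (k : ℕ) : ℝ :=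
  if ∑ i ∈ Finset.range k, x i ≤ a then (∏ i ∈ Finset.range k, (1 + b i))⁻¹ else 0

section cutoffWeight

variable {a : ℝ} {b x : ℕ → ℝ}

lemma one_le_prod_range_one_add (hb : ∀ i, 0 ≤ b i) (k : ℕ) :
    1 ≤ ∏ i ∈ Finset.range k, (1 + b i) :=
  Finset.one_le_prod fun i _ => by linarith [hb i]

lemma cutoffWeight_nonneg (hb : ∀ i, 0 ≤ b i) (k : ℕ) : 0 ≤ cutoffWeight a b x k := by
  unfold cutoffWeight
  have := one_le_prod_range_one_add hb k
  split_ifs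
  · positivity
  · exact le_rfl

lemma cutoffWeight_le_one (hb : ∀ i, 0 ≤ b i) (k : ℕ) : cutoffWeight a b x k ≤ 1 := by
  unfold cutoffWeight
  split_ifs
  · exact inv_le_one_of_one_le₀ (one_le_prod_range_one_add hb k)
  · exact zero_le_one

lemma cutoffWeight_succ_mul_le (hb : ∀ i, 0 ≤ b i) (hx : ∀ i, 0 ≤ x i) (k : ℕ) :
    cutoffWeight a b x (k + 1) * (1 + b k) ≤ cutoffWeight a b x k := by
  by_cases h : ∑ i ∈ Finset.range (k + 1), x i ≤ a
  · have h' : ∑ i ∈ Finset.range k, x i ≤ a := by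
      rw [Finset.sum_range_succ] at h
      linarith [hx k]
    have hpos : 0 < 1 + b k := by linarith [hb k]
    rw [cutoffWeight, cutoffWeight, if_pos h, if_pos h', Finset.prod_range_succ, mul_inv,
      inv_mul_cancel_right₀ hpos.ne']
  · rw [cutoffWeight, if_neg h, zero_mul]
    exact cutoffWeight_nonneg hb k

lemma sum_cutoffWeight_mul_le (hb : ∀ i, 0 ≤ b i) (hx : ∀ i, 0 ≤ x i) (ha : 0 ≤ a) (n : ℕ) :
    ∑ k ∈ Finset.range n, cutoffWeight a b x (k + 1) * x k ≤ a := by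
  refine (Finset.sum_le_sum fun k _ => ?_).trans (sum_range_ite_le_of_nonneg hx ha n)
  split_ifs with h
  · exact mul_le_of_le_one_left (hx k) (cutoffWeight_le_one hb _)
  · rw [cutoffWeight, if_neg h, zero_mul]

lemma measurable_cutoffWeight {Ω : Type*} {m : MeasurableSpace Ω} {β ξ : ℕ → Ω → ℝ} (a : ℝ)
    {k : ℕ} (hβ : ∀ i < k, Measurable (β i)) (hξ : ∀ i < k, Measurable (ξ i)) :
    Measurable fun ω => cutoffWeight a (β · ω) (ξ · ω) k := by
  refine Measurable.ite (measurableSet_le ?_ measurable_const) (Measurable.inv ?_)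
    measurable_const
  · exact Finset.measurable_sum _ fun i hi => hξ i (Finset.mem_range.1 hi)
  · exact Finset.measurable_prod _ fun i hi => (hβ i (Finset.mem_range.1 hi)).const_add 1

end cutoffWeight

/-- Robbins–Siegmund. Let `(Ω, 𝓕, P)` be a probability space with a
filtration `𝓕₀ ⊆ 𝓕₁ ⊆ …`, and for each `k` let `z k`, `β k`, `ξ k`, `ζ k` be non-negative
`𝓕ₖ`-measurable (integrable) random variables. If `∑ᵢ βᵢ < ∞` a.s., `∑ᵢ ξᵢ < ∞` a.s., and
`E[z (k+1) | 𝓕 k] ≤ (1 + β k) z k + ξ k − ζ k` a.s. for all `k`, then `z k` converges a.s.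
to a finite-valued random variable and `∑ᵢ ζᵢ < ∞` a.s. -/
theorem robbins_siegmund
    {Ω : Type*} {m0 : MeasurableSpace Ω} (P : Measure Ω) [IsProbabilityMeasure P]
    (ℱ : Filtration ℕ m0)
    (z β ξ ζ : ℕ → Ω → ℝ)
    (hz_nonneg : ∀ k ω, 0 ≤ z k ω) (hβ_nonneg : ∀ k ω, 0 ≤ β k ω)
    (hξ_nonneg : ∀ k ω, 0 ≤ ξ k ω) (hζ_nonneg : ∀ k ω, 0 ≤ ζ k ω)
    (hz_meas : ∀ k, Measurable[ℱ k] (z k)) (hβ_meas : ∀ k, Measurable[ℱ k] (β k))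
    (hξ_meas : ∀ k, Measurable[ℱ k] (ξ k)) (hζ_meas : ∀ k, Measurable[ℱ k] (ζ k))
    (hz_int : ∀ k, Integrable (z k) P) (hβ_int : ∀ k, Integrable (β k) P)
    (hξ_int : ∀ k, Integrable (ξ k) P) (hζ_int : ∀ k, Integrable (ζ k) P)
    (hβ_sum : ∀ᵐ ω ∂P, Summable fun i => β i ω)
    (hξ_sum : ∀ᵐ ω ∂P, Summable fun i => ξ i ω)
    (hineq : ∀ k, ∀ᵐ ω ∂P,
      (P[z (k + 1) | ℱ k]) ω ≤ (1 + β k ω) * z k ω + ξ k ω - ζ k ω) :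
    (∀ᵐ ω ∂P, ∃ c : ℝ, Tendsto (fun k => z k ω) atTop (𝓝 c)) ∧
      (∀ᵐ ω ∂P, Summable fun i => ζ i ω) := by
  set w : ℕ → ℕ → Ω → ℝ := fun N k ω => cutoffWeight N (β · ω) (ξ · ω) k
  have hw_nonneg : ∀ N k ω, 0 ≤ w N k ω := fun N k ω =>
    cutoffWeight_nonneg (fun i => hβ_nonneg i ω) k
  have hw_le : ∀ N k, ∀ᵐ ω ∂P, ‖w N k ω‖ ≤ 1 := fun N k => .of_forall fun ω => by
    rw [Real.norm_of_nonneg (hw_nonneg N k ω)]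
    exact cutoffWeight_le_one (fun i => hβ_nonneg i ω) k
  have hw_meas : ∀ N j k, k ≤ j + 1 → Measurable[ℱ j] (w N k) := fun N j k hk =>
    measurable_cutoffWeight N
      (fun i hi => (hβ_meas i).mono (ℱ.mono (by omega)) le_rfl)
      (fun i hi => (hξ_meas i).mono (ℱ.mono (by omega)) le_rfl)
  have hw_int : ∀ N k {f : Ω → ℝ}, Integrable f P → Integrable (w N k * f) P := fun N k f hf =>
    hf.bdd_mul ((hw_meas N k k k.le_succ).mono (ℱ.le k) le_rfl).aestronglyMeasurable (hw_le N k)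
  have hcond : ∀ N k, P[w N (k + 1) * z (k + 1) | ℱ k] ≤ᵐ[P]
      w N k * z k + w N (k + 1) * ξ k - w N (k + 1) * ζ k := by
    intro N k
    filter_upwards [hineq k, condExp_mul_of_stronglyMeasurable_left
      (hw_meas N k (k + 1) le_rfl).stronglyMeasurable (hw_int N (k + 1) (hz_int (k + 1)))
      (hz_int (k + 1))] with ω h1 h2
    have h3 := mul_le_mul_of_nonneg_left h1 (hw_nonneg N (k + 1) ω)
    have h4 : w N (k + 1) ω * (1 + β k ω) ≤ w N k ω :=
      cutoffWeight_succ_mul_le (fun i => hβ_nonneg i ω) (fun i => hξ_nonneg i ω) k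
    have h5 := mul_le_mul_of_nonneg_right h4 (hz_nonneg k ω)
    rw [h2]
    simp only [Pi.add_apply, Pi.sub_apply, Pi.mul_apply]
    linarith
  have hmain : ∀ᵐ ω ∂P, ∀ N, (∃ c, Tendsto (fun k => (w N k * z k) ω) atTop (𝓝 c)) ∧
      Summable fun i => (w N (i + 1) * ζ i) ω :=
    ae_all_iff.2 fun N => ae_tendsto_and_summable_of_condExp_le
      (x := fun k => w N (k + 1) * ξ k)
      (fun k ω => mul_nonneg (hw_nonneg N k ω) (hz_nonneg k ω))
      (fun k ω => mul_nonneg (hw_nonneg N (k + 1) ω) (hξ_nonneg k ω))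
      (fun k ω => mul_nonneg (hw_nonneg N (k + 1) ω) (hζ_nonneg k ω))
      (fun k => (hw_meas N k k k.le_succ).mul (hz_meas k))
      (fun k => (hw_meas N k (k + 1) le_rfl).mul (hξ_meas k))
      (fun k => (hw_meas N k (k + 1) le_rfl).mul (hζ_meas k))
      (fun k => hw_int N k (hz_int k)) (fun k => hw_int N (k + 1) (hξ_int k))
      (fun k => hw_int N (k + 1) (hζ_int k)) N.cast_nonneg
      (fun k ω => sum_cutoffWeight_mul_le (fun i => hβ_nonneg i ω) (fun i => hξ_nonneg i ω)
        N.cast_nonneg k)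
      (hcond N)
  rw [← eventually_and]
  filter_upwards [hmain, hβ_sum, hξ_sum] with ω hω hβω hξω
  obtain ⟨N, hN⟩ := exists_nat_ge (∑' i, ξ i ω)
  obtain ⟨⟨c, hc⟩, hζω⟩ := hω N
  set p : ℕ → ℝ := fun k => ∏ i ∈ Finset.range k, (1 + β i ω)
  have hp_pos : ∀ k, 0 < p k := fun k =>
    zero_lt_one.trans_le (one_le_prod_range_one_add (fun i => hβ_nonneg i ω) k)
  have hp_mul : ∀ k t, p k * (w N k ω * t) = t := by
    intro k t
    have hle : ∑ i ∈ Finset.range k, ξ i ω ≤ N :=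
      (hξω.sum_le_tsum _ fun i _ => hξ_nonneg i ω).trans hN
    have hwk : w N k ω = (p k)⁻¹ := if_pos hle
    rw [hwk, mul_inv_cancel_left₀ (hp_pos k).ne']
  have hp : Tendsto p atTop (𝓝 (∏' i, (1 + β i ω))) :=
    (Real.multipliable_one_add_of_summable hβω).hasProd.tendsto_prod_nat
  refine ⟨⟨_, (hp.mul hc).congr fun k => hp_mul k (z k ω)⟩, ?_⟩
  obtain ⟨C, hC⟩ := hp.bddAbove_range
  refine (hζω.mul_left C).of_nonneg_of_le (fun i => hζ_nonneg i ω) fun i => ?_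
  rw [← hp_mul (i + 1) (ζ i ω)]
  exact mul_le_mul_of_nonneg_right (hC ⟨i + 1, rfl⟩)
    (mul_nonneg (hw_nonneg N (i + 1) ω) (hζ_nonneg i ω))
end

section
/- Let Z be a non-empty closed subset of a finite-dimensional Hilbert space H, let φ : [0,∞) → [0,∞) be a strictly increasing function with φ(t) → ∞ as t → ∞, and let (x^k)_{k ∈ {0,1,…}} be a sequence of H-valued random variables. If φ(‖x^k − z‖) converges almost surely to a finite-valued non-negative random variable for every z ∈ Z, then: (i) the sequence (x^k) is bounded almost surely; and (ii) if additionally the cluster points of (x^k) lie in Z almost surely, then (x^k) converges almost surely to a Z-valued random variable. -/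
open MeasureTheory Filter Topology

/-- If `φ` is strictly increasing on `[0, ∞)`, `φ ∘ t` converges, and `t` is frequently at most
`a`, then `t` is eventually below any `b > a`. -/
theorem StrictMonoOn.eventually_lt_of_frequently_le {ι : Type*} {l : Filter ι} {φ : ℝ → ℝ}
    (hφ : StrictMonoOn φ (Set.Ici 0)) {t : ι → ℝ} (ht : ∀ i, 0 ≤ t i) {c : ℝ}
    (hc : Tendsto (fun i => φ (t i)) l (𝓝 c)) {a b : ℝ} (ha : 0 ≤ a) (hab : a < b)
    (hfreq : ∃ᶠ i in l, t i ≤ a) : ∀ᶠ i in l, t i < b := by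
  have hb : 0 ≤ b := ha.trans hab.le
  have hca : c ≤ φ a :=
    le_of_tendsto_of_frequently hc (hfreq.mono fun i hi => hφ.monotoneOn (ht i) ha hi)
  filter_upwards [hc.eventually_lt_const (hca.trans_lt (hφ ha hb hab))] with i hi
  exact (hφ.lt_iff_lt (ht i) hb).1 hi

/-- If `φ` is increasing on `[0, ∞)` and tends to infinity, a sequence `u` such that
`φ ‖u k - z‖` converges is bounded. -/
theorem MonotoneOn.exists_norm_le_of_tendsto {E : Type*} [SeminormedAddCommGroup E] {φ : ℝ → ℝ}
    (hφ : MonotoneOn φ (Set.Ici 0)) (hφ_top : Tendsto φ atTop atTop) {u : ℕ → E} {z : E} {c : ℝ}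
    (hc : Tendsto (fun k => φ ‖u k - z‖) atTop (𝓝 c)) : ∃ C : ℝ, ∀ k, ‖u k‖ ≤ C := by
  obtain ⟨M, hM⟩ := hc.bddAbove_range
  obtain ⟨T, hT, hT0⟩ := ((hφ_top.eventually_gt_atTop M).and (eventually_ge_atTop 0)).exists
  refine ⟨T + ‖z‖, fun k => ?_⟩
  have hk : ‖u k - z‖ < T := by
    by_contra! h
    exact absurd (hφ hT0 (norm_nonneg _) h) ((hM ⟨k, rfl⟩).trans_lt hT).not_ge
  linarith [norm_le_norm_sub_add (u k) z]

/-- If `φ` is strictly increasing on `[0, ∞)`, `p` is a cluster point of `u` that lies in the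
closure of `D`, and `φ ‖u i - z‖` converges for each `z ∈ D`, then `u` converges to `p`. -/
theorem MapClusterPt.tendsto_of_strictMonoOn {ι E : Type*} [SeminormedAddCommGroup E]
    {l : Filter ι} {φ : ℝ → ℝ} (hφ : StrictMonoOn φ (Set.Ici 0)) {u : ι → E} {D : Set E} {p : E}
    (hu : MapClusterPt p l u) (hp : p ∈ closure D)
    (hD : ∀ z ∈ D, ∃ c : ℝ, Tendsto (fun i => φ ‖u i - z‖) l (𝓝 c)) :
    Tendsto u l (𝓝 p) := by
  rw [Metric.tendsto_nhds]
  intro ε hε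
  obtain ⟨z, hzD, hz⟩ := Metric.mem_closure_iff.1 hp (ε / 4) (by positivity)
  obtain ⟨c, hc⟩ := hD z hzD
  have hfreq : ∃ᶠ i in l, ‖u i - z‖ ≤ ε / 2 := by
    refine (hu.frequently (Metric.ball_mem_nhds p (by positivity : 0 < ε / 4))).mono fun i hi => ?_
    rw [← dist_eq_norm]
    linarith [dist_triangle (u i) p z, Metric.mem_ball.1 hi]
  filter_upwards [hφ.eventually_lt_of_frequently_le (fun i => norm_nonneg _) hc
    (by positivity) (by linarith : ε / 2 < 3 * ε / 4) hfreq] with i hi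
  rw [← dist_eq_norm] at hi
  linarith [dist_triangle (u i) z p, dist_comm z p]

/-- Let `Z` be a non-empty closed subset of a finite-dimensional Hilbert
space `H`, `φ : [0,∞) → [0,∞)` strictly increasing with `φ(t) → ∞`, and `(xᵏ)` a sequence of
`H`-valued random variables such that `φ(‖xᵏ − z‖)` converges a.s. to a finite-valued
non-negative random variable for every `z ∈ Z`. Then (i) `(xᵏ)` is a.s. bounded, and
(ii) if additionally the cluster points of `(xᵏ)` lie in `Z` a.s., then `(xᵏ)` converges
a.s. to a `Z`-valued random variable. -/
theorem stochastic_sequence_convergence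
    {H : Type*} [NormedAddCommGroup H] [InnerProductSpace ℝ H] [FiniteDimensional ℝ H]
    [MeasurableSpace H] [BorelSpace H]
    {Ω : Type*} [MeasurableSpace Ω] (P : Measure Ω) [IsProbabilityMeasure P]
    (Z : Set H) (hZne : Z.Nonempty) (hZclosed : IsClosed Z)
    (φ : ℝ → ℝ) (hφ_mono : StrictMonoOn φ (Set.Ici 0))
    (hφ_nonneg : ∀ t, 0 ≤ t → 0 ≤ φ t)
    (hφ_top : Tendsto φ atTop atTop)
    (x : ℕ → Ω → H) (hx_meas : ∀ k, Measurable (x k))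
    (hconv : ∀ z ∈ Z, ∀ᵐ ω ∂P, ∃ c : ℝ, 0 ≤ c ∧
      Tendsto (fun k => φ ‖x k ω - z‖) atTop (𝓝 c)) :
    (∀ᵐ ω ∂P, ∃ C : ℝ, ∀ k, ‖x k ω‖ ≤ C) ∧
      ((∀ᵐ ω ∂P, ∀ p : H, MapClusterPt p atTop (fun k => x k ω) → p ∈ Z) →
        ∀ᵐ ω ∂P, ∃ p ∈ Z, Tendsto (fun k => x k ω) atTop (𝓝 p)) := by
  have hbdd : ∀ᵐ ω ∂P, ∃ C : ℝ, ∀ k, ‖x k ω‖ ≤ C := by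
    obtain ⟨z, hz⟩ := hZne
    filter_upwards [hconv z hz] with ω ⟨c, _, hc⟩
    exact hφ_mono.monotoneOn.exists_norm_le_of_tendsto hφ_top hc
  refine ⟨hbdd, fun hclus => ?_⟩
  obtain ⟨D, hDZ, hD, hZD⟩ :=
    (TopologicalSpace.IsSeparable.of_separableSpace Z).exists_countable_dense_subset
  filter_upwards [hbdd, hclus, (ae_ball_iff hD).2 fun z hz => hconv z (hDZ hz)]
    with ω ⟨C, hC⟩ hω hconvω
  obtain ⟨p, -, hp⟩ := (isCompact_closedBall (0 : H) C).exists_mapClusterPt_of_frequently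
    (l := atTop) (f := fun k => x k ω) (Frequently.of_forall fun k => by simpa using hC k)
  have hpZ := hω p hp
  refine ⟨p, hpZ, hp.tendsto_of_strictMonoOn hφ_mono (hZD hpZ) fun z hz => ?_⟩
  obtain ⟨c, -, hc⟩ := hconvω z hz
  exact ⟨c, hc⟩
end
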